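/- arXiv:cond-mat/9910325 — 2 statements merged into one kernel-verified Lean document; each statement's English description precedes it below -/
import Mathlib

section
/- For every (θ₁,θ₂) ∈ ℝ², the subspace ℋ_T(θ₁,θ₂) of 𝒮'(ℝ) is a complex vector space of dimension exactly N. -/
open MeasureTheory Complex SchwartzMap

/-- The Hilbert space of the torus `ℋ_T(θ₁,θ₂)`: the space of tempered distributions `u`
on `ℝ` satisfying `T_Q u = exp(iθ₁) u` and `T_P u = exp(iθ₂) u`, where
`(T_Q u)(φ) = u(x ↦ φ(x+1))` and `T_P u` is the product of `u` with the smooth function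
`x ↦ exp(2πiNx)`.  (The action of `T_Q`, `T_P` is expressed by quantifying over the
Schwartz function `ψ` representing the translated, resp. multiplied, test function.) -/
noncomputable def HT (N : ℕ) (θ₁ θ₂ : ℝ) : Submodule ℂ (SchwartzMap ℝ ℂ →L[ℂ] ℂ) where
  carrier := {u |
    (∀ φ ψ : SchwartzMap ℝ ℂ, (∀ x : ℝ, ψ x = φ (x + 1)) →
      u ψ = Complex.exp (Complex.I * θ₁) * u φ) ∧
    (∀ φ ψ : SchwartzMap ℝ ℂ,
      (∀ x : ℝ, ψ x = Complex.exp (2 * Real.pi * Complex.I * N * x) * φ x) →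
      u ψ = Complex.exp (Complex.I * θ₂) * u φ)}
  add_mem' := by
    rintro u v ⟨hu1, hu2⟩ ⟨hv1, hv2⟩
    constructor
    · intro φ ψ h
      simp only [ContinuousLinearMap.add_apply, hu1 φ ψ h, hv1 φ ψ h]
      ring
    · intro φ ψ h
      simp only [ContinuousLinearMap.add_apply, hu2 φ ψ h, hv2 φ ψ h]
      ring
  zero_mem' := by
    constructor <;> intro φ ψ h <;> simp
  smul_mem' := by
    rintro c u ⟨hu1, hu2⟩
    constructor
    · intro φ ψ h
      simp only [ContinuousLinearMap.smul_apply, hu1 φ ψ h, smul_eq_mul]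
      ring
    · intro φ ψ h
      simp only [ContinuousLinearMap.smul_apply, hu2 φ ψ h, smul_eq_mul]
      ring

theorem had_deriv (a : ℝ) (g : ℝ → ℂ) (hg : ContDiff ℝ 1 g) (n : ℕ) (x : ℝ) :
    HasDerivAt (fun x : ℝ => ∫ t in (0:ℝ)..1, (t ^ n) • g (a + t * (x - a)))
      (∫ t in (0:ℝ)..1, (t ^ (n + 1)) • deriv g (a + t * (x - a))) x := by
  have hg' : Continuous (deriv g) := hg.continuous_deriv le_rfl
  have hgc : Continuous g := hg.continuous
  have hK : IsCompact ((fun p : ℝ × ℝ => ‖(p.1 ^ (n + 1)) • deriv g (a + p.1 * (p.2 - a))‖) ''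
      (Set.Icc (0:ℝ) 1 ×ˢ Metric.closedBall x 1)) := by
    apply (isCompact_Icc.prod (isCompact_closedBall x 1)).image
    fun_prop
  obtain ⟨C, hC⟩ := hK.bddAbove
  refine (intervalIntegral.hasDerivAt_integral_of_dominated_loc_of_deriv_le
    (F := fun x t => (t ^ n) • g (a + t * (x - a)))
    (F' := fun x t => (t ^ (n + 1)) • deriv g (a + t * (x - a)))
    (bound := fun _ => C)
    (Metric.closedBall_mem_nhds x one_pos) ?_ ?_ ?_ ?_ ?_ ?_).2
  · refine Filter.Eventually.of_forall fun y => ?_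
    apply Continuous.aestronglyMeasurable
    fun_prop
  · apply Continuous.intervalIntegrable
    fun_prop
  · apply Continuous.aestronglyMeasurable
    fun_prop
  · refine Filter.Eventually.of_forall fun t ht y hy => ?_
    rw [Set.uIoc_of_le zero_le_one] at ht
    exact hC ⟨(t, y), ⟨⟨ht.1.le, ht.2⟩, hy⟩, rfl⟩
  · apply Continuous.intervalIntegrable
    fun_prop
  · refine Filter.Eventually.of_forall fun t ht y hy => ?_
    have h1 : HasDerivAt (fun y : ℝ => a + t * (y - a)) t y := by
      simpa using (((hasDerivAt_id y).sub_const a).const_mul t).const_add a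
    have h2 : HasDerivAt g (deriv g (a + t * (y - a))) (a + t * (y - a)) :=
      (hg.differentiable one_ne_zero _).hasDerivAt
    have h3 := (h2.scomp y h1).const_smul (t ^ n)
    rw [smul_smul, ← pow_succ] at h3
    exact h3

theorem had_contDiff (a : ℝ) (m : ℕ) : ∀ (g : ℝ → ℂ) (_ : ContDiff ℝ (⊤ : ℕ∞) g) (n : ℕ),
    ContDiff ℝ m (fun x : ℝ => ∫ t in (0:ℝ)..1, (t ^ n) • g (a + t * (x - a))) := by
  induction m with
  | zero =>
    intro g hg n
    have hg1 : ContDiff ℝ 1 g := hg.of_le (by exact_mod_cast le_top)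
    have : Differentiable ℝ (fun x : ℝ => ∫ t in (0:ℝ)..1, (t ^ n) • g (a + t * (x - a))) :=
      fun x => (had_deriv a g hg1 n x).differentiableAt
    exact contDiff_zero.2 this.continuous
  | succ m ih =>
    intro g hg n
    have hg1 : ContDiff ℝ 1 g := hg.of_le (by exact_mod_cast le_top)
    have : ((m + 1 : ℕ) : WithTop ℕ∞) = (m : WithTop ℕ∞) + 1 := by norm_cast
    rw [this, contDiff_succ_iff_deriv]
    refine ⟨fun x => (had_deriv a g hg1 n x).differentiableAt, by simp, ?_⟩
    have hd : deriv (fun x : ℝ => ∫ t in (0:ℝ)..1, (t ^ n) • g (a + t * (x - a))) =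
        fun x : ℝ => ∫ t in (0:ℝ)..1, (t ^ (n + 1)) • deriv g (a + t * (x - a)) :=
      funext fun x => (had_deriv a g hg1 n x).deriv
    rw [hd]
    refine ih _ ?_ _
    exact (contDiff_infty_iff_deriv.1 hg).2

theorem contDiff_dslope (a : ℝ) (f : ℝ → ℂ) (hf : ContDiff ℝ (⊤ : ℕ∞) f) :
    ContDiff ℝ (⊤ : ℕ∞) (dslope f a) := by
  have hf' : ContDiff ℝ (⊤ : ℕ∞) (deriv f) := (contDiff_infty_iff_deriv.1 hf).2
  have hfd : Differentiable ℝ f := (contDiff_infty_iff_deriv.1 hf).1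
  have key : dslope f a = fun x : ℝ => ∫ t in (0:ℝ)..1, (t ^ 0) • deriv f (a + t * (x - a)) := by
    funext x
    by_cases hx : x = a
    · subst hx
      simp
    · rw [dslope_of_ne _ hx, slope_def_module]
      have h : ∫ t in (0:ℝ)..1, (x - a) • deriv f (a + t * (x - a)) =
          f (a + 1 * (x - a)) - f (a + 0 * (x - a)) := by
        refine intervalIntegral.integral_eq_sub_of_hasDerivAt
          (f := fun t : ℝ => f (a + t * (x - a))) (fun t _ => ?_) ?_
        · have h1 : HasDerivAt (fun t : ℝ => a + t * (x - a)) (x - a) t := by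
            simpa using ((hasDerivAt_id t).mul_const (x - a)).const_add a
          exact (hfd _).hasDerivAt.scomp t h1
        · apply Continuous.intervalIntegrable
          have := hf'.continuous
          fun_prop
      rw [intervalIntegral.integral_smul] at h
      simp only [pow_zero, one_smul]
      have hne : x - a ≠ 0 := sub_ne_zero.2 hx
      rw [inv_smul_eq_iff₀ hne, h]
      simp
  rw [key, contDiff_infty]
  intro m
  have hres := had_contDiff a m _ hf' 0
  simpa using hres

/-- Division of a compactly supported smooth function by a function with simple zeros. -/
theorem smooth_division (φ E : ℝ → ℂ) (hφ : ContDiff ℝ (⊤ : ℕ∞) φ) (hE : ContDiff ℝ (⊤ : ℕ∞) E)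
    (hc : HasCompactSupport φ) (h0 : ∀ x, E x = 0 → φ x = 0) (h1 : ∀ x, E x = 0 → deriv E x ≠ 0) :
    ∃ ψ : ℝ → ℂ, ContDiff ℝ (⊤ : ℕ∞) ψ ∧ HasCompactSupport ψ ∧ ∀ x, φ x = E x * ψ x := by
  classical
  refine ⟨fun x => if E x = 0 then deriv φ x / deriv E x else φ x / E x, ?_, ?_, ?_⟩
  · rw [contDiff_iff_contDiffAt]
    intro a
    by_cases ha : E a = 0
    · have hEs := contDiff_dslope a E hE
      have hφs := contDiff_dslope a φ hφ
      have hne : dslope E a a ≠ 0 := by rw [dslope_same]; exact h1 a ha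
      have hd : ContDiffAt ℝ (⊤ : ℕ∞) (fun x => dslope φ a x / dslope E a x) a :=
        by
          simp only [div_eq_mul_inv]
          exact hφs.contDiffAt.mul (hEs.contDiffAt.inv hne)
      refine hd.congr_of_eventuallyEq ?_
      filter_upwards [hEs.continuous.continuousAt.eventually_ne hne] with x hx
      by_cases hxa : x = a
      · subst hxa
        simp [ha]
      · have hxa' : x - a ≠ 0 := sub_ne_zero.2 hxa
        rw [dslope_of_ne _ hxa, slope_def_module, ha, sub_zero] at hx
        rw [dslope_of_ne _ hxa, dslope_of_ne _ hxa, slope_def_module, slope_def_module, ha,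
          h0 a ha, sub_zero, sub_zero]
        have hEx : E x ≠ 0 := by
          intro h
          simp [h] at hx
        rw [if_neg hEx]
        simp only [Complex.real_smul]
        have : (((x - a)⁻¹ : ℝ) : ℂ) ≠ 0 := by exact_mod_cast inv_ne_zero hxa'
        rw [mul_div_mul_left _ _ this]
    · have hd : ContDiffAt ℝ (⊤ : ℕ∞) (fun x => φ x / E x) a :=
        by
          simp only [div_eq_mul_inv]
          exact hφ.contDiffAt.mul (hE.contDiffAt.inv ha)
      refine hd.congr_of_eventuallyEq ?_
      filter_upwards [hE.continuous.continuousAt.eventually_ne ha] with x hx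
      rw [if_neg hx]
  · refine HasCompactSupport.intro' hc (isClosed_tsupport φ) fun x hx => ?_
    have he : φ =ᶠ[nhds x] 0 := notMem_tsupport_iff_eventuallyEq.1 hx
    have hd : deriv φ x = 0 := by
      rw [he.deriv_eq]; simp
    have hv : φ x = 0 := he.eq_of_nhds
    simp [hd, hv]
  · intro x
    by_cases hx : E x = 0
    · simp [hx, h0 x hx]
    · simp only [if_neg hx]
      field_simp

theorem cutoff_bound (g : ℝ → ℝ) (c : ContDiffBump (0:ℝ)) (hg : g = fun x => 1 - c x) (i : ℕ) :
    ∃ C : ℝ, 0 ≤ C ∧ ∀ x, ‖iteratedDeriv i g x‖ ≤ C := by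
  have hcs : ContDiff ℝ (⊤ : ℕ∞) c := c.contDiff
  let s : SchwartzMap ℝ ℝ := c.hasCompactSupport.toSchwartzMap hcs
  refine ⟨1 + SchwartzMap.seminorm ℝ 0 i s, by positivity, fun x => ?_⟩
  have hle : ((i : ℕ) : WithTop ℕ∞) ≤ ((⊤ : ℕ∞) : WithTop ℕ∞) := by exact_mod_cast le_top
  rw [hg, iteratedDeriv_fun_sub contDiffAt_const (hcs.contDiffAt.of_le hle)]
  refine (norm_sub_le _ _).trans (add_le_add ?_ ?_)
  · rw [iteratedDeriv_const]
    split_ifs <;> simp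
  · have := SchwartzMap.le_seminorm' ℝ 0 i s x
    rw [pow_zero, one_mul] at this
    exact this

theorem cutoff_seminorm (φ : SchwartzMap ℝ ℂ) (c : ContDiffBump (0:ℝ)) (hc : c.rIn = 1) (k l : ℕ) :
    ∃ M : ℝ, 0 ≤ M ∧ ∀ (n : ℕ) (ψ : SchwartzMap ℝ ℂ),
      (∀ x, ψ x = (1 - c ((1 / (n + 1 : ℝ)) * x)) • φ x) →
      SchwartzMap.seminorm ℂ k l ψ ≤ M * (1 / (n + 1 : ℝ)) := by
  set g : ℝ → ℝ := fun x => 1 - c x with hg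
  have hcs : ContDiff ℝ (⊤ : ℕ∞) c := c.contDiff
  have hgs : ContDiff ℝ (⊤ : ℕ∞) g := contDiff_const.sub hcs
  choose C hC0 hC using cutoff_bound g c hg
  refine ⟨∑ i ∈ Finset.range (l + 1), (l.choose i : ℝ) * C i *
    SchwartzMap.seminorm ℂ (k + 1) (l - i) φ, ?_, ?_⟩
  · exact Finset.sum_nonneg fun i _ => mul_nonneg (mul_nonneg (by positivity) (hC0 i)) (by positivity)
  intro n ψ hψ
  set r : ℝ := 1 / (n + 1 : ℝ) with hr
  have hr0 : 0 < r := by positivity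
  have hr1 : r ≤ 1 := by
    rw [hr, div_le_one (by positivity)]
    have : (0:ℝ) ≤ n := by positivity
    linarith
  have hgr : ContDiff ℝ (⊤ : ℕ∞) (fun x => g (r * x)) := hgs.comp (contDiff_const.mul contDiff_id)
  have hψ' : (ψ : ℝ → ℂ) = fun x => g (r * x) • φ x := funext hψ
  have hle : ∀ i : ℕ, ((i : ℕ) : WithTop ℕ∞) ≤ ((⊤ : ℕ∞) : WithTop ℕ∞) := fun i => by
    exact_mod_cast le_top
  refine SchwartzMap.seminorm_le_bound ℂ k l ψ ?_ ?_
  · refine mul_nonneg ?_ hr0.le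
    exact Finset.sum_nonneg fun i _ => mul_nonneg (mul_nonneg (by positivity) (hC0 i)) (by positivity)
  intro x
  rw [hψ']
  have h1 := norm_iteratedFDeriv_smul_le hgr (φ.smooth ⊤) x (hle l)
  refine (mul_le_mul_of_nonneg_left h1 (by positivity)).trans ?_
  rw [Finset.mul_sum, Finset.sum_mul]
  refine Finset.sum_le_sum fun i _ => ?_
  have hkey : ‖iteratedFDeriv ℝ i (fun x => g (r * x)) x‖ * ‖x‖ ^ k ≤ C i * (r * ‖x‖ ^ (k + 1)) := by
    rw [norm_iteratedFDeriv_eq_norm_iteratedDeriv]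
    by_cases hx : |r * x| < 1
    · have hev : (fun x => g (r * x)) =ᶠ[nhds x] fun _ => (0:ℝ) := by
        have hcont : Continuous fun y : ℝ => |r * y| := by fun_prop
        filter_upwards [hcont.continuousAt.eventually_lt continuousAt_const hx] with y hy
        have : c (r * y) = 1 := c.one_of_mem_closedBall (by
          rw [hc, mem_closedBall_zero_iff, Real.norm_eq_abs]; exact hy.le)
        simp [hg, this]
      rw [hev.iteratedDeriv_eq, iteratedDeriv_const]
      simp only [ite_self, norm_zero, zero_mul]
      exact mul_nonneg (hC0 i) (by positivity)
    · push Not at hx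
      rw [iteratedDeriv_comp_const_mul (hgs.of_le (hle i)), norm_mul]
      have h2 : ‖r ^ i‖ ≤ 1 := by
        rw [norm_pow, Real.norm_of_nonneg hr0.le]
        exact pow_le_one₀ hr0.le hr1
      have h3 : ‖r ^ i‖ * ‖iteratedDeriv i g (r * x)‖ ≤ C i :=
        (mul_le_of_le_one_left (norm_nonneg _) h2).trans (hC i _)
      refine mul_le_mul h3 ?_ (by positivity) (hC0 i)
      rw [abs_mul, abs_of_pos hr0] at hx
      rw [pow_succ, Real.norm_eq_abs]
      have : 0 ≤ |x| ^ k := by positivity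
      nlinarith
  have h4 := SchwartzMap.le_seminorm ℂ (k + 1) (l - i) φ x
  calc ‖x‖ ^ k * ((l.choose i : ℝ) * ‖iteratedFDeriv ℝ i (fun x => g (r * x)) x‖ *
        ‖iteratedFDeriv ℝ (l - i) φ x‖)
      = (l.choose i : ℝ) * (‖iteratedFDeriv ℝ i (fun x => g (r * x)) x‖ * ‖x‖ ^ k) *
        ‖iteratedFDeriv ℝ (l - i) φ x‖ := by ring
    _ ≤ (l.choose i : ℝ) * (C i * (r * ‖x‖ ^ (k + 1))) * ‖iteratedFDeriv ℝ (l - i) φ x‖ := by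
        gcongr
    _ = (l.choose i : ℝ) * C i * r * (‖x‖ ^ (k + 1) * ‖iteratedFDeriv ℝ (l - i) φ x‖) := by ring
    _ ≤ (l.choose i : ℝ) * C i * r * SchwartzMap.seminorm ℂ (k + 1) (l - i) φ := by
        have := hC0 i
        gcongr
    _ = _ := by ring

/-- Two continuous functionals agreeing on compactly supported functions; here: vanishing. -/
theorem clm_eq_zero_of_compact (u : SchwartzMap ℝ ℂ →L[ℂ] ℂ)
    (h : ∀ φ : SchwartzMap ℝ ℂ, HasCompactSupport φ → u φ = 0) : u = 0 := by
  ext φ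
  let c : ContDiffBump (0:ℝ) := ⟨1, 2, one_pos, one_lt_two⟩
  have hcs : ContDiff ℝ (⊤ : ℕ∞) c := c.contDiff
  have hsm : ∀ n : ℕ, ContDiff ℝ (⊤ : ℕ∞) (fun x : ℝ => c ((1 / (n + 1 : ℝ)) * x) • φ x) := fun n =>
    (hcs.comp (contDiff_const.mul contDiff_id)).smul (φ.smooth ⊤)
  have hcp : ∀ n : ℕ, HasCompactSupport (fun x : ℝ => c ((1 / (n + 1 : ℝ)) * x) • φ x) := fun n => by
    refine HasCompactSupport.intro (isCompact_closedBall (0:ℝ) (2 * (n + 1))) fun x hx => ?_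
    rw [mem_closedBall_zero_iff, Real.norm_eq_abs, not_le] at hx
    have : c ((1 / (n + 1 : ℝ)) * x) = 0 := c.zero_of_le_dist (by
      have hn : (0:ℝ) < n + 1 := by positivity
      rw [dist_zero_right, Real.norm_eq_abs, abs_mul, abs_of_pos (by positivity : 0 < 1 / (n + 1 : ℝ)),
        one_div, inv_mul_eq_div, le_div_iff₀ hn]
      exact hx.le)
    rw [this, zero_smul]
  let Φ : ℕ → SchwartzMap ℝ ℂ := fun n => (hcp n).toSchwartzMap (hsm n)
  have hΦ : ∀ n x, Φ n x = c ((1 / (n + 1 : ℝ)) * x) • φ x := fun n x => rfl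
  have hlim : Filter.Tendsto Φ Filter.atTop (nhds φ) := by
    rw [(schwartz_withSeminorms ℂ ℝ ℂ).tendsto_nhds]
    rintro ⟨k, l⟩ ε hε
    obtain ⟨M, hM0, hM⟩ := cutoff_seminorm φ c rfl k l
    have ht : Filter.Tendsto (fun n : ℕ => M * (1 / (n + 1 : ℝ))) Filter.atTop (nhds (M * 0)) :=
      tendsto_one_div_add_atTop_nhds_zero_nat.const_mul M
    rw [mul_zero] at ht
    filter_upwards [ht.eventually_lt_const hε] with n hn
    refine lt_of_le_of_lt ?_ hn
    rw [schwartzSeminormFamily_apply, map_sub_rev]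
    refine hM n _ fun x => ?_
    rw [sub_smul, one_smul, ← hΦ]
    rfl
  have h2 := (u.continuous.tendsto φ).comp hlim
  have h3 : (u ∘ Φ) = fun _ => 0 := funext fun n => h _ (hcp n)
  rw [h3] at h2
  exact tendsto_nhds_unique h2 tendsto_const_nhds

/-- The lattice points supporting the distributions. -/
noncomputable def latX (N : ℕ) (θ₂ : ℝ) (k : ℤ) : ℝ := (θ₂ / (2 * Real.pi) + k) / N

theorem latX_add (N : ℕ) (hN : 1 ≤ N) (θ₂ : ℝ) (k m : ℤ) :
    latX N θ₂ (k + m * N) = latX N θ₂ k + m := by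
  have : (N : ℝ) ≠ 0 := by positivity
  unfold latX
  push_cast
  field_simp
  ring

theorem exp_latX (N : ℕ) (hN : 1 ≤ N) (θ₂ : ℝ) (k : ℤ) :
    Complex.exp (2 * Real.pi * Complex.I * N * (latX N θ₂ k : ℝ)) =
      Complex.exp (Complex.I * θ₂) := by
  have : (N : ℂ) ≠ 0 := by exact_mod_cast (by omega : N ≠ 0)
  have hpi : (Real.pi : ℂ) ≠ 0 := by exact_mod_cast Real.pi_ne_zero
  rw [Complex.exp_eq_exp_iff_exists_int]
  refine ⟨k, ?_⟩
  unfold latX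
  push_cast
  field_simp

theorem eq_latX (N : ℕ) (hN : 1 ≤ N) (θ₂ x : ℝ)
    (h : Complex.exp (2 * Real.pi * Complex.I * N * x) = Complex.exp (Complex.I * θ₂)) :
    ∃ k : ℤ, x = latX N θ₂ k := by
  rw [Complex.exp_eq_exp_iff_exists_int] at h
  obtain ⟨k, hk⟩ := h
  refine ⟨k, ?_⟩
  have hN' : (N : ℝ) ≠ 0 := by positivity
  have h2 : ((2 * Real.pi * N * x : ℝ) : ℂ) = ((θ₂ + k * (2 * Real.pi) : ℝ) : ℂ) := by
    apply mul_left_cancel₀ Complex.I_ne_zero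
    push_cast
    linear_combination hk
  have h3 : 2 * Real.pi * N * x = θ₂ + k * (2 * Real.pi) := by exact_mod_cast h2
  have hpi := Real.pi_ne_zero
  unfold latX
  field_simp
  linarith

/-- Real bump of radius `1/(2N)`. -/
noncomputable def bmp (N : ℕ) (hN : 1 ≤ N) : ContDiffBump (0:ℝ) where
  rIn := 1 / (4 * N)
  rOut := 1 / (2 * N)
  rIn_pos := by positivity
  rIn_lt_rOut := by
    have : (0:ℝ) < N := by positivity
    apply one_div_lt_one_div_of_lt <;> linarith

theorem bmp_smooth (N : ℕ) (hN : 1 ≤ N) (a : ℝ) :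
    ContDiff ℝ (⊤ : ℕ∞) (fun x : ℝ => ((bmp N hN (x - a) : ℝ) : ℂ)) :=
  Complex.ofRealCLM.contDiff.comp
    ((bmp N hN).contDiff.comp (contDiff_id.sub contDiff_const))

theorem bmp_compact (N : ℕ) (hN : 1 ≤ N) (a : ℝ) :
    HasCompactSupport (fun x : ℝ => ((bmp N hN (x - a) : ℝ) : ℂ)) := by
  refine HasCompactSupport.intro (isCompact_closedBall a (bmp N hN).rOut) fun x hx => ?_
  rw [Metric.mem_closedBall, not_le] at hx
  have : bmp N hN (x - a) = 0 := (bmp N hN).zero_of_le_dist (by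
    rw [dist_zero_right, ← dist_eq_norm]; exact hx.le)
  rw [this, Complex.ofReal_zero]

/-- Bump Schwartz function centred at the `k`-th lattice point. -/
noncomputable def eta (N : ℕ) (hN : 1 ≤ N) (θ₂ : ℝ) (k : ℤ) : SchwartzMap ℝ ℂ :=
  (bmp_compact N hN (latX N θ₂ k)).toSchwartzMap (bmp_smooth N hN (latX N θ₂ k))

theorem eta_apply (N : ℕ) (hN : 1 ≤ N) (θ₂ : ℝ) (k : ℤ) (x : ℝ) :
    eta N hN θ₂ k x = ((bmp N hN (x - latX N θ₂ k) : ℝ) : ℂ) := rfl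

theorem eta_latX (N : ℕ) (hN : 1 ≤ N) (θ₂ : ℝ) (k m : ℤ) :
    eta N hN θ₂ k (latX N θ₂ m) = if m = k then 1 else 0 := by
  rw [eta_apply]
  split_ifs with h
  · subst h
    rw [sub_self, (bmp N hN).one_of_mem_closedBall
      (Metric.mem_closedBall_self (bmp N hN).rIn_pos.le), Complex.ofReal_one]
  · have hNp : (0:ℝ) < N := by positivity
    have h1 : (1:ℝ) ≤ |((m - k : ℤ) : ℝ)| := by
      rw [← Int.cast_abs]
      exact_mod_cast Int.one_le_abs (sub_ne_zero.2 h)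
    have : bmp N hN (latX N θ₂ m - latX N θ₂ k) = 0 := (bmp N hN).zero_of_le_dist (by
      have e : latX N θ₂ m - latX N θ₂ k = ((m - k : ℤ) : ℝ) / N := by
        unfold latX; push_cast; ring
      rw [dist_zero_right, Real.norm_eq_abs, e, abs_div, abs_of_pos hNp]
      change 1 / (2 * (N:ℝ)) ≤ _
      rw [div_le_div_iff₀ (by positivity) hNp]
      nlinarith)
    rw [this, Complex.ofReal_zero]

theorem eta_shift (N : ℕ) (hN : 1 ≤ N) (θ₂ : ℝ) (k : ℤ) (x : ℝ) :
    eta N hN θ₂ k x = eta N hN θ₂ (k + N) (x + 1) := by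
  have := latX_add N hN θ₂ k 1
  rw [one_mul] at this
  rw [eta_apply, eta_apply, this, Int.cast_one, add_sub_add_right_eq_sub]

theorem HT_eta_zero (N : ℕ) (hN : 1 ≤ N) (θ₁ θ₂ : ℝ) (u : SchwartzMap ℝ ℂ →L[ℂ] ℂ)
    (hu : u ∈ HT N θ₁ θ₂) (h : ∀ j : Fin N, u (eta N hN θ₂ ((j : ℕ) : ℤ)) = 0) (k : ℤ) :
    u (eta N hN θ₂ k) = 0 := by
  have step : ∀ k : ℤ, u (eta N hN θ₂ k) = 0 ↔ u (eta N hN θ₂ (k + N)) = 0 := fun k => by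
    rw [hu.1 _ _ (eta_shift N hN θ₂ k)]
    simp [Complex.exp_ne_zero]
  have hNz : (0:ℤ) < N := by omega
  have main : ∀ q : ℤ, ∀ j : Fin N, u (eta N hN θ₂ (((j : ℕ) : ℤ) + q * N)) = 0 := by
    intro q j
    induction q using Int.induction_on with
    | zero => simpa using h j
    | succ i ih =>
      have := (step _).1 ih
      rwa [show ((j : ℕ) : ℤ) + ((i : ℤ) + 1) * N = ((j : ℕ) : ℤ) + (i : ℤ) * N + N by ring]
    | pred i ih =>
      apply (step _).2
      rwa [show ((j : ℕ) : ℤ) + (-(i : ℤ) - 1) * N + N = ((j : ℕ) : ℤ) + -(i : ℤ) * N by ring]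
  have h1 := Int.emod_nonneg k hNz.ne'
  have h2 := Int.emod_lt_of_pos k hNz
  have h3 := main (k / N) ⟨(k % N).toNat, by omega⟩
  have h4 : (((k % N).toNat : ℕ) : ℤ) + k / N * N = k := by
    rw [Int.toNat_of_nonneg h1, mul_comm]
    exact Int.emod_add_mul_ediv k N
  simp only at h3
  rwa [h4] at h3

/-- An element of `HT` kills compactly supported functions vanishing on the lattice. -/
theorem HT_vanish (N : ℕ) (hN : 1 ≤ N) (θ₁ θ₂ : ℝ) (u : SchwartzMap ℝ ℂ →L[ℂ] ℂ)
    (hu : u ∈ HT N θ₁ θ₂) (φ : SchwartzMap ℝ ℂ) (hc : HasCompactSupport φ)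
    (h : ∀ k, φ (latX N θ₂ k) = 0) : u φ = 0 := by
  have hb : ContDiff ℝ (⊤ : ℕ∞)
      (fun x : ℝ => Complex.exp (2 * Real.pi * Complex.I * N * x)) :=
    (contDiff_const.mul Complex.ofRealCLM.contDiff).cexp
  set E : ℝ → ℂ := fun x => Complex.exp (2 * Real.pi * Complex.I * N * x) -
    Complex.exp (Complex.I * θ₂) with hEdef
  have hE : ContDiff ℝ (⊤ : ℕ∞) E := hb.sub contDiff_const
  have hEd : ∀ x : ℝ, deriv E x ≠ 0 := by
    intro x
    have h1 : HasDerivAt (fun x : ℝ => 2 * Real.pi * Complex.I * N * (x : ℂ))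
        (2 * Real.pi * Complex.I * N * 1) x :=
      (Complex.ofRealCLM.hasDerivAt (x := x)).const_mul _
    have h2 : HasDerivAt E _ x := h1.cexp.sub_const _
    rw [h2.deriv]
    have : (N : ℂ) ≠ 0 := by exact_mod_cast (by omega : N ≠ 0)
    have hpi : (Real.pi : ℂ) ≠ 0 := by exact_mod_cast Real.pi_ne_zero
    simp [Complex.exp_ne_zero, this, hpi]
  obtain ⟨ψ, hψs, hψc, hψ⟩ := smooth_division φ E (φ.smooth ⊤) hE hc (fun x hx => by
    obtain ⟨k, rfl⟩ := eq_latX N hN θ₂ x (sub_eq_zero.1 hx)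
    exact h k) (fun x _ => hEd x)
  let Ψ : SchwartzMap ℝ ℂ := hψc.toSchwartzMap hψs
  have hΨ : ∀ x, Ψ x = ψ x := fun _ => rfl
  have h1 := hu.2 Ψ (φ + Complex.exp (Complex.I * θ₂) • Ψ) (fun x => by
    change φ x + Complex.exp (Complex.I * θ₂) * Ψ x = _
    rw [hψ x, hΨ, hEdef]
    ring)
  rw [map_add, map_smul, smul_eq_mul] at h1
  simpa using h1

theorem HT_inj (N : ℕ) (hN : 1 ≤ N) (θ₁ θ₂ : ℝ) (u : SchwartzMap ℝ ℂ →L[ℂ] ℂ)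
    (hu : u ∈ HT N θ₁ θ₂) (h : ∀ j : Fin N, u (eta N hN θ₂ ((j : ℕ) : ℤ)) = 0) : u = 0 := by
  apply clm_eq_zero_of_compact
  intro φ hc
  have hz := HT_eta_zero N hN θ₁ θ₂ u hu h
  obtain ⟨R, hR⟩ := hc.isCompact.isBounded.subset_closedBall (0:ℝ)
  have hNp : (0:ℝ) < N := by positivity
  obtain ⟨M, hM⟩ := exists_nat_gt (R * N + |θ₂ / (2 * Real.pi)|)
  have hfin : ∀ m : ℤ, m ∉ Finset.Icc (-(M : ℤ)) M → φ (latX N θ₂ m) = 0 := by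
    intro m hm
    by_contra hne
    apply hm
    have h1 := hR (subset_tsupport _ hne)
    rw [mem_closedBall_zero_iff, Real.norm_eq_abs, latX, abs_div, abs_of_pos hNp,
      div_le_iff₀ hNp] at h1
    have h2 : |(m : ℝ)| < M := by
      have := abs_add_le (θ₂ / (2 * Real.pi) + m) (-(θ₂ / (2 * Real.pi)))
      rw [abs_neg] at this
      have e : θ₂ / (2 * Real.pi) + m + -(θ₂ / (2 * Real.pi)) = m := by ring
      rw [e] at this
      linarith
    rw [abs_lt] at h2
    rw [Finset.mem_Icc]
    constructor
    · exact_mod_cast h2.1.le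
    · exact_mod_cast h2.2.le
  set S := Finset.Icc (-(M : ℤ)) M
  have hsum : ∀ T : Finset ℤ, HasCompactSupport
      ((∑ k ∈ T, φ (latX N θ₂ k) • eta N hN θ₂ k : SchwartzMap ℝ ℂ) : ℝ → ℂ) := by
    intro T
    induction T using Finset.induction_on with
    | empty =>
      rw [Finset.sum_empty]
      exact HasCompactSupport.zero
    | insert a T ha ih =>
      rw [Finset.sum_insert ha]
      refine HasCompactSupport.add (f := fun x => φ (latX N θ₂ a) • eta N hN θ₂ a x) ?_ ih
      exact HasCompactSupport.smul_left (f := fun _ => φ (latX N θ₂ a))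
        (bmp_compact N hN (latX N θ₂ a))
  have h1 := HT_vanish N hN θ₁ θ₂ u hu (φ - ∑ k ∈ S, φ (latX N θ₂ k) • eta N hN θ₂ k)
    (hc.sub (hsum S)) (fun m => by
      rw [sub_apply, sum_apply]
      simp only [smul_apply, eta_latX, smul_eq_mul, mul_ite, mul_one, mul_zero]
      rw [Finset.sum_ite_eq]
      split_ifs with hm
      · simp
      · simp [hfin m hm])
  rw [map_sub, map_sum] at h1
  simpa [hz] using h1

theorem summable_base : Summable fun m : ℤ => 1 / (1 + |(m : ℝ)|) ^ 2 := by
  have h := (Real.summable_one_div_int_add_rpow (1/2) 2).2 one_lt_two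
  refine Summable.of_nonneg_of_le (fun m => by positivity) (fun m => ?_) h
  have hne : (m : ℝ) + 1/2 ≠ 0 := by
    intro h0
    have : (2 * m + 1 : ℝ) = 0 := by linarith
    have : (2 * m + 1 : ℤ) = 0 := by exact_mod_cast this
    omega
  have hp : 0 < |(m : ℝ) + 1/2| := abs_pos.2 hne
  rw [Real.rpow_two]
  apply one_div_le_one_div_of_le (by positivity)
  have := abs_add_le (m : ℝ) (1/2)
  rw [abs_of_pos (by norm_num : (0:ℝ) < 1/2)] at this
  gcongr
  linarith

theorem term_bound (a : ℝ) (φ : SchwartzMap ℝ ℂ) (m : ℤ) :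
    ‖φ (a + m)‖ ≤ (4 * (1 + |a|) ^ 2 * (Finset.Iic ((2, 0) : ℕ × ℕ)).sup
      (schwartzSeminormFamily ℂ ℝ ℂ) φ) * (1 / (1 + |(m : ℝ)|) ^ 2) := by
  have h := SchwartzMap.one_add_le_sup_seminorm_apply (𝕜 := ℂ) (m := (2, 0)) (k := 2) (n := 0)
    le_rfl le_rfl φ (a + m)
  rw [norm_iteratedFDeriv_zero, Real.norm_eq_abs] at h
  have e : (Finset.Iic ((2, 0) : ℕ × ℕ)).sup (fun m => SchwartzMap.seminorm ℂ m.1 m.2) φ =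
    (Finset.Iic ((2, 0) : ℕ × ℕ)).sup (schwartzSeminormFamily ℂ ℝ ℂ) φ := rfl
  rw [e] at h
  set S := (Finset.Iic ((2, 0) : ℕ × ℕ)).sup (schwartzSeminormFamily ℂ ℝ ℂ) φ
  rw [mul_one_div, le_div_iff₀ (by positivity)]
  have h1 : 1 + |(m : ℝ)| ≤ (1 + |a|) * (1 + |a + m|) := by
    have := abs_add_le (a + m) (-a)
    rw [abs_neg, show a + m + -a = (m : ℝ) by ring] at this
    nlinarith [abs_nonneg a, abs_nonneg (a + m)]
  calc ‖φ (a + m)‖ * (1 + |(m : ℝ)|) ^ 2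
      ≤ ‖φ (a + m)‖ * ((1 + |a|) * (1 + |a + m|)) ^ 2 := by gcongr
    _ = (1 + |a|) ^ 2 * ((1 + |a + m|) ^ 2 * ‖φ (a + m)‖) := by ring
    _ ≤ (1 + |a|) ^ 2 * (2 ^ 2 * S) := by gcongr
    _ = _ := by ring

theorem norm_phase (θ : ℝ) (m : ℤ) : ‖Complex.exp (-(Complex.I * θ * m))‖ = 1 := by
  have : -(Complex.I * θ * m) = ((-(θ * m) : ℝ) : ℂ) * Complex.I := by push_cast; ring
  rw [this, Complex.norm_exp_ofReal_mul_I]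

theorem comb_norm_bound (a θ : ℝ) (φ : SchwartzMap ℝ ℂ) (m : ℤ) :
    ‖Complex.exp (-(Complex.I * θ * m)) * φ (a + m)‖ ≤
    (4 * (1 + |a|) ^ 2 * (Finset.Iic ((2, 0) : ℕ × ℕ)).sup
      (schwartzSeminormFamily ℂ ℝ ℂ) φ) * (1 / (1 + |(m : ℝ)|) ^ 2) := by
  rw [norm_mul, norm_phase, one_mul]
  exact term_bound a φ m

theorem comb_summable (a θ : ℝ) (φ : SchwartzMap ℝ ℂ) :
    Summable fun m : ℤ => Complex.exp (-(Complex.I * θ * m)) * φ (a + m) :=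
  Summable.of_norm_bounded (summable_base.mul_left _) (comb_norm_bound a θ φ)

/-- The twisted Dirac comb. -/
noncomputable def comb (a θ : ℝ) : SchwartzMap ℝ ℂ →L[ℂ] ℂ :=
  SchwartzMap.mkCLMtoNormedSpace
    (fun φ => ∑' m : ℤ, Complex.exp (-(Complex.I * θ * m)) * φ (a + m))
    (fun f g => by
      rw [← (comb_summable a θ f).tsum_add (comb_summable a θ g)]
      refine tsum_congr fun m => ?_
      rw [add_apply, mul_add])
    (fun c f => by
      rw [RingHom.id_apply, smul_eq_mul, ← tsum_mul_left]
      refine tsum_congr fun m => ?_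
      rw [smul_apply, smul_eq_mul]
      ring)
    (by
      refine ⟨Finset.Iic (2, 0), 4 * (1 + |a|) ^ 2 * ∑' m : ℤ, 1 / (1 + |(m : ℝ)|) ^ 2,
        mul_nonneg (by positivity) (tsum_nonneg fun m => by positivity), fun f => ?_⟩
      refine (tsum_of_norm_bounded (summable_base.mul_left _).hasSum
        (comb_norm_bound a θ f)).trans (le_of_eq ?_)
      rw [tsum_mul_left]
      ring)

theorem comb_apply (a θ : ℝ) (φ : SchwartzMap ℝ ℂ) :
    comb a θ φ = ∑' m : ℤ, Complex.exp (-(Complex.I * θ * m)) * φ (a + m) := rfl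

theorem comb_mem (N : ℕ) (hN : 1 ≤ N) (θ₁ θ₂ : ℝ) (k : ℤ) :
    comb (latX N θ₂ k) θ₁ ∈ HT N θ₁ θ₂ := by
  constructor
  · intro φ ψ h
    rw [comb_apply, comb_apply, ← tsum_mul_left,
      ← (Equiv.addRight (1:ℤ)).tsum_eq (fun m : ℤ => Complex.exp (Complex.I * θ₁) *
        (Complex.exp (-(Complex.I * θ₁ * m)) * φ (latX N θ₂ k + m)))]
    refine tsum_congr fun m => ?_
    rw [h, Equiv.coe_addRight, ← mul_assoc, ← Complex.exp_add]
    congr 2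
    · push_cast; ring
    · push_cast; ring
  · intro φ ψ h
    rw [comb_apply, comb_apply, ← tsum_mul_left]
    refine tsum_congr fun m => ?_
    rw [h, ← latX_add N hN, exp_latX N hN]
    ring

theorem comb_eta (N : ℕ) (hN : 1 ≤ N) (θ₁ θ₂ : ℝ) (i j : Fin N) :
    comb (latX N θ₂ ((j : ℕ) : ℤ)) θ₁ (eta N hN θ₂ ((i : ℕ) : ℤ)) = if i = j then 1 else 0 := by
  have hNz : (0:ℤ) < N := by omega
  rw [comb_apply, tsum_eq_single 0]
  · rw [← latX_add N hN, eta_latX]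
    by_cases h : i = j
    · subst h; simp
    · have : ¬ ((j : ℕ) : ℤ) = ((i : ℕ) : ℤ) := fun h' => h (Fin.ext (by omega))
      simp [h, this]
  · intro m hm
    rw [← latX_add N hN, eta_latX, if_neg, mul_zero]
    intro h
    have hi := i.2
    have hj := j.2
    rcases lt_or_gt_of_ne hm with h0 | h0
    · nlinarith
    · nlinarith

/-- Evaluation on the bumps. -/
noncomputable def evalHT (N : ℕ) (hN : 1 ≤ N) (θ₁ θ₂ : ℝ) : HT N θ₁ θ₂ →ₗ[ℂ] (Fin N → ℂ) where
  toFun u := fun j => u.1 (eta N hN θ₂ ((j : ℕ) : ℤ))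
  map_add' _ _ := rfl
  map_smul' _ _ := rfl

theorem evalHT_bij (N : ℕ) (hN : 1 ≤ N) (θ₁ θ₂ : ℝ) :
    Function.Bijective (evalHT N hN θ₁ θ₂) := by
  constructor
  · rw [injective_iff_map_eq_zero]
    intro u hu
    exact Subtype.ext (HT_inj N hN θ₁ θ₂ u.1 u.2 (fun j => congrFun hu j))
  · intro c
    refine ⟨∑ j, c j • ⟨comb (latX N θ₂ ((j : ℕ) : ℤ)) θ₁, comb_mem N hN θ₁ θ₂ _⟩, ?_⟩
    rw [map_sum]
    funext i
    rw [Finset.sum_apply]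
    simp only [map_smul, Pi.smul_apply]
    have : ∀ j : Fin N, evalHT N hN θ₁ θ₂ ⟨comb (latX N θ₂ ((j : ℕ) : ℤ)) θ₁,
        comb_mem N hN θ₁ θ₂ _⟩ i = if i = j then 1 else 0 := fun j => comb_eta N hN θ₁ θ₂ i j
    simp [this]

/-- For every `(θ₁,θ₂) ∈ ℝ²`, the subspace `ℋ_T(θ₁,θ₂)` of tempered distributions is a
complex vector space of dimension exactly `N`. -/
theorem stmt_3 (N : ℕ) (hN : 1 ≤ N) (θ₁ θ₂ : ℝ) :
    Module.finrank ℂ (HT N θ₁ θ₂) = N := by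
  rw [(LinearEquiv.ofBijective (evalHT N hN θ₁ θ₂) (evalHT_bij N hN θ₁ θ₂)).finrank_eq,
    Module.finrank_fin_fun]
end

section
/- Let f : ℝ² → ℝ be continuously differentiable and satisfy f(θ₁ + 2π, θ₂) = f(θ₁, θ₂) + 2πN₁ and f(θ₁, θ₂ + 2π) = f(θ₁, θ₂) + 2πN₂ for all (θ₁,θ₂), for some integers N₁, N₂. Let c_{n₁,n₂} = (1/(2π)²) ∫₀^{2π}∫₀^{2π} exp(i f(θ₁,θ₂)) exp(−i(n₁θ₁ + n₂θ₂)) dθ₁ dθ₂. Then Σ_{(n₁,n₂)∈ℤ²} n₁ |c_{n₁,n₂}|² = N₁ and Σ_{(n₁,n₂)∈ℤ²} n₂ |c_{n₁,n₂}|² = N₂ (both series converging); in other words, the mean position ⟨n₁⟩, ⟨n₂⟩ of the state with phase function f is quantized and equal to the homotopy type (N₁, N₂) of f. -/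
open Real Complex
open MeasureTheory Set UnitAddTorus

noncomputable local instance : MeasureSpace UnitAddCircle := ⟨AddCircle.haarAddCircle⟩

local instance : IsProbabilityMeasure (volume : Measure UnitAddCircle) :=
  inferInstanceAs (IsProbabilityMeasure AddCircle.haarAddCircle)

theorem torus_int (K : ℝ × ℝ → ℂ) (hK : Continuous K) (Φ : UnitAddTorus (Fin 2) → ℂ)
    (h : ∀ x : Fin 2 → ℝ, (∀ i, x i ∈ Ioc (0:ℝ) 1) →
      Φ (fun i => (x i : UnitAddCircle)) = K (2 * π * x 0, 2 * π * x 1)) :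
    ∫ t, Φ t = (1 / (2 * π) ^ 2) *
      ∫ θ₁ in (0 : ℝ)..(2 * π), ∫ θ₂ in (0 : ℝ)..(2 * π), K (θ₁, θ₂) := by
  rw [integral_preimage Φ (fun _ => 0)]
  have hm : MeasurableSet {x : Fin 2 → ℝ | ∀ i, x i ∈ Ioc (0:ℝ) (0+1)} :=
    MeasurableSet.univ_pi' (fun i => measurableSet_Ioc)
  have e1 : ∫ x in {x : Fin 2 → ℝ | ∀ i, x i ∈ Ioc (0:ℝ) (0+1)}, Φ (fun i => (x i : UnitAddCircle))
     = ∫ x in {x : Fin 2 → ℝ | ∀ i, x i ∈ Ioc (0:ℝ) (0+1)}, K (2 * π * x 0, 2 * π * x 1) := by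
    apply setIntegral_congr_fun hm
    intro x hx
    exact h x (by simpa using hx)
  have e2 : ∫ x in {x : Fin 2 → ℝ | ∀ i, x i ∈ Ioc (0:ℝ) (0+1)}, K (2 * π * x 0, 2 * π * x 1)
     = ∫ p in Ioc (0:ℝ) 1 ×ˢ Ioc (0:ℝ) 1, K (2 * π * p.1, 2 * π * p.2) := by
    have := (volume_preserving_finTwoArrow ℝ).setIntegral_preimage_emb
      (MeasurableEquiv.measurableEmbedding _)
      (fun p : ℝ × ℝ => K (2 * π * p.1, 2 * π * p.2)) (Ioc (0:ℝ) 1 ×ˢ Ioc (0:ℝ) 1)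
    rw [← this]
    congr 2
    ext x
    simp [Fin.forall_fin_two, MeasurableEquiv.finTwoArrow]
  have e3 : ∫ p in Ioc (0:ℝ) 1 ×ˢ Ioc (0:ℝ) 1, K (2 * π * p.1, 2 * π * p.2)
     = ∫ x in (0:ℝ)..1, ∫ y in (0:ℝ)..1, K (2 * π * x, 2 * π * y) := by
    rw [Measure.volume_eq_prod, setIntegral_prod]
    · simp [intervalIntegral.integral_of_le]
    · have : ContinuousOn (fun p : ℝ × ℝ => K (2 * π * p.1, 2 * π * p.2))
        (Icc (0:ℝ) 1 ×ˢ Icc (0:ℝ) 1) := by fun_prop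
      exact (this.integrableOn_compact (isCompact_Icc.prod isCompact_Icc)).mono_set
        (prod_mono Ioc_subset_Icc_self Ioc_subset_Icc_self)
  rw [e1, e2, e3]
  have pi0 : (2 * π : ℝ) ≠ 0 := by positivity
  have e4 : ∀ x : ℝ, ∫ y in (0:ℝ)..1, K (2 * π * x, 2 * π * y)
    = (2 * π)⁻¹ • ∫ y in (0:ℝ)..(2 * π), K (2 * π * x, y) := by
    intro x
    rw [intervalIntegral.integral_comp_mul_left (fun y => K (2 * π * x, y)) pi0]
    simp
  simp_rw [e4]
  rw [intervalIntegral.integral_smul,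
    intervalIntegral.integral_comp_mul_left (fun x => ∫ y in (0:ℝ)..(2 * π), K (x, y)) pi0]
  simp only [mul_zero, mul_one, smul_smul]
  rw [Complex.real_smul]
  congr 1
  push_cast
  field_simp

/-- pull back to the torus -/
noncomputable def pull (G : ℝ × ℝ → ℂ) (t : UnitAddTorus (Fin 2)) : ℂ :=
  G (2 * π * (measurableEquivPiIoc (fun _ => (0:ℝ)) t).1 0,
     2 * π * (measurableEquivPiIoc (fun _ => (0:ℝ)) t).1 1)

theorem pull_coe (G : ℝ × ℝ → ℂ) (x : Fin 2 → ℝ) (hx : ∀ i, x i ∈ Ioc (0:ℝ) 1) :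
    pull G (fun i => (x i : UnitAddCircle)) = G (2 * π * x 0, 2 * π * x 1) := by
  have := (measurableEquivPiIoc (fun _ : Fin 2 => (0:ℝ))).apply_symm_apply
    ⟨x, by simpa using hx⟩
  rw [coe_symm_measurableEquivPiIoc_apply] at this
  simp only [pull, this]

theorem pull_memLp (G : ℝ × ℝ → ℂ) (hG : Continuous G) : MemLp (pull G) 2 volume := by
  have hK : IsCompact (Icc (0:ℝ) 1 ×ˢ Icc (0:ℝ) 1) := isCompact_Icc.prod isCompact_Icc
  obtain ⟨C, hC⟩ := hK.exists_bound_of_continuousOn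
    (f := fun p : ℝ × ℝ => G (2 * π * p.1, 2 * π * p.2)) (by fun_prop)
  have hm : Measurable (pull G) := by
    have h1 : Measurable (fun t : UnitAddTorus (Fin 2) =>
      (measurableEquivPiIoc (fun _ => (0:ℝ)) t).1) :=
      measurable_subtype_coe.comp (MeasurableEquiv.measurable _)
    unfold pull
    apply hG.measurable.comp
    exact (((measurable_pi_apply 0).comp h1).const_mul _).prodMk
      (((measurable_pi_apply 1).comp h1).const_mul _)
  refine MemLp.of_bound hm.aestronglyMeasurable C (Filter.Eventually.of_forall fun t => ?_)
  have hp := (measurableEquivPiIoc (fun _ : Fin 2 => (0:ℝ)) t).2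
  exact hC (_, _) ⟨Ioc_subset_Icc_self (by simpa using hp 0),
    Ioc_subset_Icc_self (by simpa using hp 1)⟩

theorem mF (n : Fin 2 → ℤ) (x : Fin 2 → ℝ) :
    mFourier (-n) (fun i => (x i : UnitAddCircle)) =
      Complex.exp (-Complex.I * (n 0 * (2 * π * x 0 : ℝ) + n 1 * (2 * π * x 1 : ℝ))) := by
  simp only [mFourier, ContinuousMap.coe_mk, Fin.prod_univ_two, fourier_coe_apply,
    ← Complex.exp_add]
  congr 1
  simp
  ring

theorem pull_coeff (G : ℝ × ℝ → ℂ) (hG : Continuous G) (n : Fin 2 → ℤ) :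
    mFourierCoeff (MemLp.toLp (pull G) (pull_memLp G hG)) n = (1 / (2 * π) ^ 2) *
      ∫ θ₁ in (0 : ℝ)..(2 * π), ∫ θ₂ in (0 : ℝ)..(2 * π),
        G (θ₁, θ₂) * Complex.exp (-Complex.I * (n 0 * θ₁ + n 1 * θ₂)) := by
  have : mFourierCoeff (MemLp.toLp (pull G) (pull_memLp G hG)) n = ∫ t, mFourier (-n) t • pull G t := by
    apply integral_congr_ae
    filter_upwards [(pull_memLp G hG).coeFn_toLp] with t ht
    rw [ht]
  rw [this]
  apply torus_int (fun p => G p * Complex.exp (-Complex.I * (n 0 * p.1 + n 1 * p.2)))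
    (by fun_prop)
  intro x hx
  rw [pull_coe G x hx, mF, smul_eq_mul, mul_comm]

theorem parseval2 (G H : ℝ × ℝ → ℂ) (hG : Continuous G) (hH : Continuous H) (a b : ℤ × ℤ → ℂ)
    (ha : ∀ n : ℤ × ℤ, a n = (1 / (2 * π) ^ 2) *
      ∫ θ₁ in (0 : ℝ)..(2 * π), ∫ θ₂ in (0 : ℝ)..(2 * π),
        G (θ₁, θ₂) * Complex.exp (-Complex.I * (n.1 * θ₁ + n.2 * θ₂)))
    (hb : ∀ n : ℤ × ℤ, b n = (1 / (2 * π) ^ 2) *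
      ∫ θ₁ in (0 : ℝ)..(2 * π), ∫ θ₂ in (0 : ℝ)..(2 * π),
        H (θ₁, θ₂) * Complex.exp (-Complex.I * (n.1 * θ₁ + n.2 * θ₂))) :
    HasSum (fun n => (starRingEnd ℂ) (a n) * b n) ((1 / (2 * π) ^ 2) *
      ∫ θ₁ in (0 : ℝ)..(2 * π), ∫ θ₂ in (0 : ℝ)..(2 * π),
        (starRingEnd ℂ) (G (θ₁, θ₂)) * H (θ₁, θ₂)) := by
  have key : HasSum (fun n => (starRingEnd ℂ) (mFourierCoeff (MemLp.toLp (pull G) (pull_memLp G hG)) n) *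
      mFourierCoeff (MemLp.toLp (pull H) (pull_memLp H hH)) n)
      (∫ t, (starRingEnd ℂ) ((MemLp.toLp (pull G) (pull_memLp G hG)) t) * (MemLp.toLp (pull H) (pull_memLp H hH)) t) :=
    hasSum_prod_mFourierCoeff (MemLp.toLp (pull G) (pull_memLp G hG)) (MemLp.toLp (pull H) (pull_memLp H hH))
  simp only [pull_coeff G hG, pull_coeff H hH] at key
  have : ∫ t, (starRingEnd ℂ) ((MemLp.toLp (pull G) (pull_memLp G hG)) t) * (MemLp.toLp (pull H) (pull_memLp H hH)) t
      = ∫ t, (starRingEnd ℂ) (pull G t) * pull H t := by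
    apply integral_congr_ae
    filter_upwards [(pull_memLp G hG).coeFn_toLp, (pull_memLp H hH).coeFn_toLp] with t h1 h2
    rw [h1, h2]
  rw [this, torus_int (fun p => (starRingEnd ℂ) (G p) * H p)
    ((Complex.continuous_conj.comp hG).mul hH) _
    (fun x hx => by rw [pull_coe G x hx, pull_coe H x hx])] at key
  rw [← (finTwoArrowEquiv ℤ).hasSum_iff]
  convert key using 2 with n
  simp [ha, hb]

/-- second-variable half -/
theorem half (f : ℝ × ℝ → ℝ) (hf : ContDiff ℝ 1 f) (N₁ N₂ : ℤ)
    (hper₂ : ∀ θ₁ θ₂ : ℝ, f (θ₁, θ₂ + 2 * π) = f (θ₁, θ₂) + 2 * π * N₂)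
    (c : ℤ × ℤ → ℂ)
    (hc : ∀ n : ℤ × ℤ, c n = (1 / (2 * π) ^ 2) *
      ∫ θ₁ in (0 : ℝ)..(2 * π), ∫ θ₂ in (0 : ℝ)..(2 * π),
        Complex.exp (Complex.I * f (θ₁, θ₂)) *
          Complex.exp (-Complex.I * (n.1 * θ₁ + n.2 * θ₂))) :
    HasSum (fun n : ℤ × ℤ => (n.2 : ℝ) * ‖c n‖ ^ 2) (N₂ : ℝ) := by
  set g : ℝ × ℝ → ℝ := fun p => fderiv ℝ f p (0, 1) with hg
  have gc : Continuous g := (hf.continuous_fderiv (by simp)).clm_apply continuous_const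
  have fc : Continuous f := hf.continuous
  have hd : ∀ x y : ℝ, HasDerivAt (fun y => f (x, y)) (g (x, y)) y := by
    intro x y
    have h1 := (hf.differentiable (by simp) (x, y)).hasFDerivAt
    have h2 : HasDerivAt (fun y : ℝ => (x, y)) ((0:ℝ), (1:ℝ)) y :=
      (hasDerivAt_const y x).prodMk (hasDerivAt_id y)
    exact h1.comp_hasDerivAt y h2
  have pz : ∀ x : ℝ, f (x, 2 * π) = f (x, 0) + 2 * π * N₂ := by
    intro x; simpa using hper₂ x 0
  have hb : ∀ n : ℤ × ℤ, (n.2 : ℂ) * c n = (1 / (2 * π) ^ 2) *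
      ∫ θ₁ in (0 : ℝ)..(2 * π), ∫ θ₂ in (0 : ℝ)..(2 * π),
        (fun p => (g p : ℂ) * Complex.exp (Complex.I * f p)) (θ₁, θ₂) *
          Complex.exp (-Complex.I * (n.1 * θ₁ + n.2 * θ₂)) := by
    intro n
    rw [hc, mul_left_comm, ← intervalIntegral.integral_const_mul]
    congr 2
    ext x
    rw [← intervalIntegral.integral_const_mul, eq_comm, ← sub_eq_zero,
      ← intervalIntegral.integral_sub
        (Continuous.intervalIntegrable (by fun_prop) _ _)
        (Continuous.intervalIntegrable (by fun_prop) _ _)]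
    have hder : ∀ y ∈ uIcc (0:ℝ) (2 * π), HasDerivAt (fun y : ℝ =>
        -Complex.I * (Complex.exp (Complex.I * f (x, y)) *
          Complex.exp (-Complex.I * (n.1 * x + n.2 * y))))
        ((g (x, y) : ℂ) * Complex.exp (Complex.I * f (x, y)) *
          Complex.exp (-Complex.I * (n.1 * x + n.2 * y)) - n.2 *
          (Complex.exp (Complex.I * f (x, y)) *
          Complex.exp (-Complex.I * (n.1 * x + n.2 * y)))) y := by
      intro y _
      have h1 := (((hd x y).ofReal_comp).const_mul Complex.I).cexp
      have h2 := ((((((hasDerivAt_id y).ofReal_comp).const_mul (n.2 : ℂ)).const_add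
        (n.1 * x : ℂ))).const_mul (-Complex.I)).cexp
      convert! (h1.mul h2).const_mul (-Complex.I) using 1
      simp only [id]
      push_cast
      linear_combination ((g (x, y) : ℂ) * Complex.exp (Complex.I * f (x, y)) *
          Complex.exp (-Complex.I * (n.1 * x + n.2 * y)) - n.2 *
          (Complex.exp (Complex.I * f (x, y)) *
          Complex.exp (-Complex.I * (n.1 * x + n.2 * y)))) * Complex.I_mul_I
    rw [intervalIntegral.integral_eq_sub_of_hasDerivAt hder
      (Continuous.intervalIntegrable (by fun_prop) _ _), sub_eq_zero]
    congr 1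
    rw [← Complex.exp_add, ← Complex.exp_add, Complex.exp_eq_exp_iff_exists_int]
    refine ⟨N₂ - n.2, ?_⟩
    rw [pz]
    push_cast
    ring
  have key := parseval2 (fun p => Complex.exp (Complex.I * f p))
    (fun p => (g p : ℂ) * Complex.exp (Complex.I * f p)) (by fun_prop) (by fun_prop) c
    (fun n => (n.2 : ℂ) * c n) hc hb
  have hv : (1 / (2 * π) ^ 2 : ℂ) *
      ∫ θ₁ in (0 : ℝ)..(2 * π), ∫ θ₂ in (0 : ℝ)..(2 * π),
        (starRingEnd ℂ) (Complex.exp (Complex.I * f (θ₁, θ₂))) *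
         ((g (θ₁, θ₂) : ℂ) * Complex.exp (Complex.I * f (θ₁, θ₂))) = ((N₂ : ℝ) : ℂ) := by
    have h1 : ∀ x y : ℝ, (starRingEnd ℂ) (Complex.exp (Complex.I * f (x, y))) *
         ((g (x, y) : ℂ) * Complex.exp (Complex.I * f (x, y))) = ((g (x, y) : ℝ) : ℂ) := by
      intro x y
      rw [← Complex.exp_conj, mul_left_comm, ← Complex.exp_add]
      simp
    have h2 : ∀ x : ℝ, ∫ y in (0:ℝ)..(2 * π), g (x, y) = 2 * π * N₂ := by
      intro x
      rw [intervalIntegral.integral_eq_sub_of_hasDerivAt (fun y _ => hd x y)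
        (Continuous.intervalIntegrable (by fun_prop) _ _), pz]
      ring
    simp_rw [h1, intervalIntegral.integral_ofReal, h2]
    have : (π : ℂ) ≠ 0 := by exact_mod_cast Real.pi_ne_zero
    simp
    field_simp
  rw [hv] at key
  rw [← Complex.hasSum_ofReal]
  convert key using 2 with n
  rw [mul_left_comm, ← Complex.normSq_eq_conj_mul_self, Complex.normSq_eq_norm_sq]
  push_cast
  rfl

/-- If `f : ℝ² → ℝ` is `C¹` with `f(θ₁+2π,θ₂) = f + 2πN₁` and `f(θ₁,θ₂+2π) = f + 2πN₂`,
and `c_{n₁,n₂}` are the Fourier coefficients of `exp(if)`, then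
`Σ n₁|c_{n₁,n₂}|² = N₁` and `Σ n₂|c_{n₁,n₂}|² = N₂`: the mean position is quantized and
equal to the homotopy type `(N₁,N₂)` of `f`. -/
theorem stmt_10 (f : ℝ × ℝ → ℝ) (hf : ContDiff ℝ 1 f) (N₁ N₂ : ℤ)
    (hper₁ : ∀ θ₁ θ₂ : ℝ, f (θ₁ + 2 * π, θ₂) = f (θ₁, θ₂) + 2 * π * N₁)
    (hper₂ : ∀ θ₁ θ₂ : ℝ, f (θ₁, θ₂ + 2 * π) = f (θ₁, θ₂) + 2 * π * N₂)
    (c : ℤ × ℤ → ℂ)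
    (hc : ∀ n : ℤ × ℤ, c n = (1 / (2 * π) ^ 2) *
      ∫ θ₁ in (0 : ℝ)..(2 * π), ∫ θ₂ in (0 : ℝ)..(2 * π),
        Complex.exp (Complex.I * f (θ₁, θ₂)) *
          Complex.exp (-Complex.I * (n.1 * θ₁ + n.2 * θ₂))) :
    HasSum (fun n : ℤ × ℤ => (n.1 : ℝ) * ‖c n‖ ^ 2) (N₁ : ℝ) ∧
    HasSum (fun n : ℤ × ℤ => (n.2 : ℝ) * ‖c n‖ ^ 2) (N₂ : ℝ) := by
  refine ⟨?_, half f hf N₁ N₂ hper₂ c hc⟩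
  have fc : Continuous f := hf.continuous
  have := half (fun p => f p.swap) (hf.comp (contDiff_snd.prodMk contDiff_fst)) N₂ N₁
    (fun x y => hper₁ y x) (fun n => c n.swap) (fun n => by
      rw [hc]
      congr 1
      have hp : (0:ℝ) ≤ 2 * π := by positivity
      simp only [intervalIntegral.integral_of_le hp]
      rw [integral_integral_swap]
      · simp [add_comm]
      · rw [Measure.prod_restrict]
        have hcont : ContinuousOn (Function.uncurry fun θ₁ θ₂ : ℝ =>
            Complex.exp (Complex.I * f (θ₁, θ₂)) *
              Complex.exp (-Complex.I * (n.swap.1 * θ₁ + n.swap.2 * θ₂)))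
            (Icc (0:ℝ) (2 * π) ×ˢ Icc (0:ℝ) (2 * π)) := by
          unfold Function.uncurry
          fun_prop
        exact (hcont.integrableOn_compact (isCompact_Icc.prod isCompact_Icc)).mono_set
          (prod_mono Ioc_subset_Icc_self Ioc_subset_Icc_self))
  rw [← (Equiv.prodComm ℤ ℤ).hasSum_iff]
  exact this
end
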